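/- Let K be the complete graph on a finite vertex set with n ≥ 2 vertices, with a nonnegative weight w(e) on each edge, and let Q be an acyclic 2-matching of K. Then there exists a Hamiltonian path H of K whose edge set contains every edge of Q; consequently, the maximum total edge weight of a Hamiltonian path of K is at least the total weight of the edges of Q. -/

import Mathlib

/-- A set of edges is a matching: each edge is non-diagonal (joins two distinct
vertices) and no two distinct edges share a vertex. -/
def IsMatchingSet {V : Type*} (M : Finset (Sym2 V)) : Prop :=
  (∀ e ∈ M, ¬ e.IsDiag) ∧
    ∀ e ∈ M, ∀ f ∈ M, e ≠ f → ∀ v : V, v ∈ e → v ∉ f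

/-- A set of edges is a perfect matching: a matching covering every vertex. -/
def IsPerfectMatchingSet {V : Type*} (M : Finset (Sym2 V)) : Prop :=
  IsMatchingSet M ∧ ∀ v : V, ∃ e ∈ M, v ∈ e

/-- A set of edges is a 2-matching: each edge is non-diagonal and every vertex
is incident to at most two of the edges. -/
def IsTwoMatchingSet {V : Type*} [DecidableEq V] (C : Finset (Sym2 V)) : Prop :=
  (∀ e ∈ C, ¬ e.IsDiag) ∧
    ∀ v : V, (C.filter (fun e => v ∈ e)).card ≤ 2

/-- A set of edges is an acyclic 2-matching: a 2-matching whose associated graph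
contains no cycle, i.e. it is a vertex-disjoint union of paths. -/
def IsAcyclicTwoMatchingSet {V : Type*} [DecidableEq V] (C : Finset (Sym2 V)) : Prop :=
  IsTwoMatchingSet C ∧ (SimpleGraph.fromEdgeSet (↑C : Set (Sym2 V))).IsAcyclic

namespace SimpleGraph

variable {V : Type*} {G : SimpleGraph V}

/-- A finite nonempty forest has a vertex with at most one neighbor. -/
theorem IsAcyclic.exists_subsingleton_neighborSet [Finite V] [Nonempty V] (hG : G.IsAcyclic) :
    ∃ v, (G.neighborSet v).Subsingleton := by
  have := Fintype.ofFinite V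
  by_contra! h
  have key : ∀ n : ℕ, ∃ (u v : V) (p : G.Walk u v), p.IsPath ∧ p.length = n := by
    intro n
    induction n with
    | zero => exact ⟨Classical.arbitrary V, _, .nil, .nil, rfl⟩
    | succ n ih =>
      obtain ⟨u, v, p, hp, rfl⟩ := ih
      obtain ⟨x, hx, y, hy, hxy⟩ := h u
      obtain ⟨z, hz, hzp⟩ : ∃ z, G.Adj u z ∧ z ∉ p.support := by
        by_contra! hall
        exact hxy ((hG.eq_snd_of_adj_start hp hx (hall x hx)).trans
          (hG.eq_snd_of_adj_start hp hy (hall y hy)).symm)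
      exact ⟨z, v, .cons hz.symm p, hp.cons hzp, rfl⟩
  obtain ⟨u, v, p, hp, hlen⟩ := key (Fintype.card V)
  exact hp.length_lt.ne hlen

/-- Every nonempty finite set of vertices of a forest has a member with at most one neighbor
in the set. -/
theorem IsAcyclic.exists_mem_subsingleton_neighbors (hG : G.IsAcyclic) {S : Finset V}
    (hS : S.Nonempty) : ∃ a ∈ S, {x | x ∈ S ∧ G.Adj a x}.Subsingleton := by
  have : Nonempty (S : Set V) := hS.to_subtype
  obtain ⟨⟨a, ha⟩, h⟩ := (hG.induce (S : Set V)).exists_subsingleton_neighborSet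
  exact ⟨a, ha, fun x hx y hy =>
    congrArg Subtype.val (@h ⟨x, hx.1⟩ hx.2 ⟨y, hy.1⟩ hy.2)⟩

/-- In a forest of maximum degree at most two, a vertex of a finite set `S` with at most one
neighbor in `S` is the start of a path in the complete graph that visits exactly `S` and
contains all edges of the forest inside `S`. -/
theorem IsAcyclic.exists_isPath_top_of_subsingleton_neighbors [DecidableEq V]
    (hG : G.IsAcyclic)
    (hdeg : ∀ v x y z, G.Adj v x → G.Adj v y → G.Adj v z → x = y ∨ x = z ∨ y = z)
    (S : Finset V) {a : V} (ha : a ∈ S) (hend : {x | x ∈ S ∧ G.Adj a x}.Subsingleton) :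
    ∃ (b : V) (p : (⊤ : SimpleGraph V).Walk a b), p.IsPath ∧ (∀ v, v ∈ p.support ↔ v ∈ S) ∧
      ∀ x ∈ S, ∀ y ∈ S, G.Adj x y → s(x, y) ∈ p.edges := by
  induction S using Finset.strongInduction generalizing a with
  | H S ih =>
  obtain hT | hT := (S.erase a).eq_empty_or_nonempty
  · have hS : ∀ v, v ∈ S ↔ v = a := fun v =>
      ⟨fun hv => by_contra fun hva => by simpa [hT] using Finset.mem_erase.mpr ⟨hva, hv⟩,
        fun hv => hv ▸ ha⟩
    refine ⟨a, .nil, .nil, by simp [hS], fun x hx y hy hxy => ?_⟩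
    exact absurd (((hS x).mp hx).trans ((hS y).mp hy).symm) hxy.ne
  · obtain ⟨c, hc, hcend, hac⟩ : ∃ c ∈ S.erase a,
        {x | x ∈ S.erase a ∧ G.Adj c x}.Subsingleton ∧ ∀ x ∈ S, G.Adj a x → x = c := by
      by_cases hn : ∃ c ∈ S, G.Adj a c
      · obtain ⟨c, hcS, hadj⟩ := hn
        refine ⟨c, Finset.mem_erase.mpr ⟨hadj.ne', hcS⟩, fun x hx y hy => ?_,
          fun x hx hax => hend ⟨hx, hax⟩ ⟨hcS, hadj⟩⟩
        have hxa := (Finset.mem_erase.mp hx.1).1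
        have hya := (Finset.mem_erase.mp hy.1).1
        rcases hdeg c a x y hadj.symm hx.2 hy.2 with h | h | h
        · exact absurd h.symm hxa
        · exact absurd h.symm hya
        · exact h
      · obtain ⟨c, hc, hcend⟩ := hG.exists_mem_subsingleton_neighbors hT
        exact ⟨c, hc, hcend, fun x hx hax => absurd ⟨x, hx, hax⟩ hn⟩
    obtain ⟨b, p, hp, hsupp, hedges⟩ := ih _ (Finset.erase_ssubset ha) hc hcend
    have hca : a ≠ c := (Finset.ne_of_mem_erase hc).symm
    refine ⟨b, .cons hca p, hp.cons (by simp [hsupp]), fun v => ?_, fun x hx y hy hxy => ?_⟩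
    · by_cases hv : v = a <;> simp [hsupp, hv, ha]
    · rw [Walk.edges_cons, List.mem_cons]
      by_cases hxa : x = a
      · subst hxa
        exact .inl (by rw [hac y hy hxy])
      by_cases hya : y = a
      · subst hya
        exact .inl (by rw [hac x hx hxy.symm, Sym2.eq_swap])
      · exact .inr (hedges x (Finset.mem_erase.mpr ⟨hxa, hx⟩) y
          (Finset.mem_erase.mpr ⟨hya, hy⟩) hxy)

end SimpleGraph

/-- In the complete graph on a finite vertex set with at least 2 vertices,
with nonnegative edge weights, every acyclic 2-matching `Q` is contained in the edge set
of some Hamiltonian path; consequently that Hamiltonian path (hence the maximum-weight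
Hamiltonian path) has total edge weight at least the total weight of `Q`. -/
theorem stmt14 {V : Type*} [Fintype V] [DecidableEq V]
    (hV : 2 ≤ Fintype.card V)
    (w : Sym2 V → ℝ) (hw : ∀ e, 0 ≤ w e)
    (Q : Finset (Sym2 V)) (hQ : IsAcyclicTwoMatchingSet Q) :
    ∃ (a b : V) (p : (⊤ : SimpleGraph V).Walk a b),
      p.IsHamiltonian ∧ (∀ e ∈ Q, e ∈ p.edges) ∧
      ∑ e ∈ Q, w e ≤ ∑ e ∈ p.edges.toFinset, w e := by
  obtain ⟨⟨hdiag, hdeg⟩, hacyc⟩ := hQ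
  have : Nonempty V := Fintype.card_pos_iff.mp (by omega)
  have hthree (v x y z : V) (hx : s(v, x) ∈ Q) (hy : s(v, y) ∈ Q) (hz : s(v, z) ∈ Q) :
      x = y ∨ x = z ∨ y = z := by
    by_contra! h
    have hsub : ({s(v, x), s(v, y), s(v, z)} : Finset (Sym2 V)) ⊆ Q.filter (v ∈ ·) := by
      simp [Finset.insert_subset_iff, hx, hy, hz]
    have hcard := (Finset.card_le_card hsub).trans (hdeg v)
    rw [Finset.card_eq_three.mpr
      ⟨_, _, _, mt Sym2.congr_right.mp h.1, mt Sym2.congr_right.mp h.2.1,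
        mt Sym2.congr_right.mp h.2.2, rfl⟩] at hcard
    omega
  obtain ⟨a, -, ha⟩ := hacyc.exists_mem_subsingleton_neighbors Finset.univ_nonempty
  obtain ⟨b, p, hp, hsupp, hedges⟩ := hacyc.exists_isPath_top_of_subsingleton_neighbors
    (fun v x y z hx hy hz => hthree v x y z hx.1 hy.1 hz.1) Finset.univ (Finset.mem_univ a) ha
  have hQp : ∀ e ∈ Q, e ∈ p.edges := by
    intro e he
    induction e with
    | h x y =>
      have hxy : x ≠ y := fun h => hdiag _ he (by simpa using h)
      exact hedges x (Finset.mem_univ x) y (Finset.mem_univ y)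
        ((SimpleGraph.fromEdgeSet_adj _).mpr ⟨he, hxy⟩)
  refine ⟨a, b, p, hp.isHamiltonian_of_mem fun v => (hsupp v).mpr (Finset.mem_univ v), hQp, ?_⟩
  exact Finset.sum_le_sum_of_subset_of_nonneg (fun e he => List.mem_toFinset.mpr (hQp e he))
    fun e _ _ => hw e
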